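/- Let G be the 12 × 12 real symmetric matrix with all diagonal entries equal to 1 and off-diagonal entries (symmetrically extended) G₁₂ = −1, G₁₃ = −√5/2, G₂₄ = −√5/2, G₃₅ = −1/2, G₅₆ = −1/2, G₆₇ = −1/2, G₇₈ = −1/2, G₈₉ = −1/2, G₈,₁₀ = −1/2, G₁₀,₁₁ = −1/2, G₁₁,₁₂ = −1/2, G₄,₁₂ = −1/2, and all other off-diagonal entries 0. Then G has exactly 9 positive eigenvalues (with multiplicity), exactly 1 negative eigenvalue, and exactly 2 zero eigenvalues; equivalently G has rank 10 and signature (9,1). -/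

import Mathlib

open Real

noncomputable def G17 : Matrix (Fin 12) (Fin 12) ℝ :=
  !![1, -1, -(Real.sqrt 5 / 2), 0, 0, 0, 0, 0, 0, 0, 0, 0;
     -1, 1, 0, -(Real.sqrt 5 / 2), 0, 0, 0, 0, 0, 0, 0, 0;
     -(Real.sqrt 5 / 2), 0, 1, 0, -(1/2), 0, 0, 0, 0, 0, 0, 0;
     0, -(Real.sqrt 5 / 2), 0, 1, 0, 0, 0, 0, 0, 0, 0, -(1/2);
     0, 0, -(1/2), 0, 1, -(1/2), 0, 0, 0, 0, 0, 0;
     0, 0, 0, 0, -(1/2), 1, -(1/2), 0, 0, 0, 0, 0;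
     0, 0, 0, 0, 0, -(1/2), 1, -(1/2), 0, 0, 0, 0;
     0, 0, 0, 0, 0, 0, -(1/2), 1, -(1/2), -(1/2), 0, 0;
     0, 0, 0, 0, 0, 0, 0, -(1/2), 1, 0, 0, 0;
     0, 0, 0, 0, 0, 0, 0, -(1/2), 0, 1, -(1/2), 0;
     0, 0, 0, 0, 0, 0, 0, 0, 0, -(1/2), 1, -(1/2);
     0, 0, 0, -(1/2), 0, 0, 0, 0, 0, 0, -(1/2), 1]

open scoped Matrix

/-- The number of positive eigenvalues of a real symmetric matrix is the positive index of inertia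
of its quadratic form. -/
lemma Matrix.IsHermitian.sigPos_toQuadraticForm' {n : Type*} [Fintype n] [DecidableEq n]
    {A : Matrix n n ℝ} (hA : A.IsHermitian) :
    sigPos A.toQuadraticForm' = (Finset.univ.filter fun j => 0 < hA.eigenvalues j).card := by
  have hU : (hA.eigenvectorUnitary : Matrix n n ℝ)ᵀ * A * (hA.eigenvectorUnitary : Matrix n n ℝ) =
      Matrix.diagonal hA.eigenvalues := by
    simpa [Unitary.conjStarAlgAut_star_apply, Matrix.star_eq_conjTranspose, Function.comp_def]
      using hA.conjStarAlgAut_star_eigenvectorUnitary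
  have e : QuadraticMap.Equivalent (QuadraticMap.weightedSumSquares ℝ hA.eigenvalues)
      A.toQuadraticForm' := by
    refine ⟨⟨Matrix.UnitaryGroup.toLinearEquiv hA.eigenvectorUnitary, fun x => ?_⟩⟩
    change (Matrix.toLinearMap₂' ℝ A) (hA.eigenvectorUnitary.1 *ᵥ x)
      (hA.eigenvectorUnitary.1 *ᵥ x) = _
    rw [Matrix.toLinearMap₂'_apply', Matrix.mulVec_mulVec, ← Matrix.vecMul_transpose,
      ← Matrix.dotProduct_mulVec, Matrix.mulVec_mulVec, ← Matrix.mul_assoc, hU]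
    simp only [dotProduct, Matrix.mulVec_diagonal, QuadraticMap.weightedSumSquares_apply,
      smul_eq_mul]
    exact Finset.sum_congr rfl fun i _ => by ring
  rw [QuadraticForm.sigPos_of_equiv_weightedSumSquares e.symm, ← Set.ncard_coe_finset]
  simp

/-- Deleting the nodes `1`, `2` and `11` (counted from `0`) from the diagram leaves the spherical
diagram `E₇ + A₁ + A₁`. -/
lemma G17_restrict_posDef :
    (G17.toQuadraticForm'.restrict (Pi.spanSubset ℝ ({1, 2, 11}ᶜ : Set (Fin 12)))).PosDef := by
  rintro ⟨x, hx⟩ hx0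
  rw [Pi.mem_spanSubset_iff] at hx
  have h1 : x 1 = 0 := hx 1 (by simp)
  have h2 : x 2 = 0 := hx 2 (by simp)
  have h11 : x 11 = 0 := hx 11 (by simp)
  have hQ : G17.toQuadraticForm' x = x 0 ^ 2 + x 3 ^ 2 + (x 4 - x 5 / 2) ^ 2
      + 3 / 4 * (x 5 - 2 / 3 * x 6) ^ 2 + 2 / 3 * (x 6 - 3 / 4 * x 7) ^ 2
      + (x 8 - x 7 / 2) ^ 2 + (x 10 - x 9 / 2) ^ 2 + 3 / 4 * (x 9 - 2 / 3 * x 7) ^ 2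
      + 1 / 24 * x 7 ^ 2 := by
    change (Matrix.toLinearMap₂' ℝ G17) x x = _
    rw [Matrix.toLinearMap₂'_apply']
    simp [G17, dotProduct, Matrix.mulVec, Fin.sum_univ_succ, h1, h2, h11]
    ring
  rw [QuadraticMap.restrict_apply, hQ]
  by_contra hneg
  have s7 := sq_nonneg (x 7)
  have s0 := sq_nonneg (x 0)
  have s3 := sq_nonneg (x 3)
  have s6 := sq_nonneg (x 6 - 3 / 4 * x 7)
  have s5 := sq_nonneg (x 5 - 2 / 3 * x 6)
  have s4 := sq_nonneg (x 4 - x 5 / 2)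
  have s8 := sq_nonneg (x 8 - x 7 / 2)
  have s9 := sq_nonneg (x 9 - 2 / 3 * x 7)
  have s10 := sq_nonneg (x 10 - x 9 / 2)
  have e7 : x 7 = 0 := pow_eq_zero_iff two_ne_zero |>.mp (by linarith)
  have e0 : x 0 = 0 := pow_eq_zero_iff two_ne_zero |>.mp (by linarith)
  have e3 : x 3 = 0 := pow_eq_zero_iff two_ne_zero |>.mp (by linarith)
  have e6 : x 6 - 3 / 4 * x 7 = 0 := pow_eq_zero_iff two_ne_zero |>.mp (by linarith)
  have e5 : x 5 - 2 / 3 * x 6 = 0 := pow_eq_zero_iff two_ne_zero |>.mp (by linarith)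
  have e4 : x 4 - x 5 / 2 = 0 := pow_eq_zero_iff two_ne_zero |>.mp (by linarith)
  have e8 : x 8 - x 7 / 2 = 0 := pow_eq_zero_iff two_ne_zero |>.mp (by linarith)
  have e9 : x 9 - 2 / 3 * x 7 = 0 := pow_eq_zero_iff two_ne_zero |>.mp (by linarith)
  have e10 : x 10 - x 9 / 2 = 0 := pow_eq_zero_iff two_ne_zero |>.mp (by linarith)
  refine hx0 (Subtype.ext (funext fun i => ?_))
  change x i = 0
  fin_cases i <;> simp only [Fin.reduceFinMk, Fin.zero_eta, Fin.mk_one] <;> linarith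

lemma G17_rank_le : G17.rank ≤ 10 := by
  have h5 : Real.sqrt 5 * Real.sqrt 5 = 5 := Real.mul_self_sqrt (by norm_num)
  let v : Fin 2 → Fin 12 → ℝ :=
    ![![1, 1, 0, 0, -√5, -(2 * √5), -(3 * √5), -(4 * √5), -(2 * √5), -(3 * √5), -(2 * √5), -√5],
      ![√5, -√5, 4, -4, 3, 2, 1, 0, 0, -1, -2, -3]]
  have hv : ∀ i, G17 *ᵥ v i = 0 := by
    intro i
    ext j
    fin_cases i <;> fin_cases j <;>
      simp [v, G17, Matrix.mulVec, dotProduct, Fin.sum_univ_succ] <;> linarith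
  have hli : LinearIndependent ℝ v := by
    rw [LinearIndependent.pair_iff]
    intro s t h
    have ht := congrFun h 2
    have hs := congrFun h 7
    simp at hs ht
    exact ⟨hs, ht⟩
  have hle : Submodule.span ℝ (Set.range v) ≤ LinearMap.ker G17.mulVecLin := by
    rw [Submodule.span_le]
    rintro _ ⟨i, rfl⟩
    exact hv i
  have h2 := Submodule.finrank_mono hle
  rw [finrank_span_eq_card hli] at h2
  have := G17.mulVecLin.finrank_range_add_finrank_ker
  simp only [Module.finrank_fin_fun, Fintype.card_fin] at this h2
  rw [Matrix.rank]
  lia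

lemma G17_not_posSemidef : ¬ G17.PosSemidef := by
  intro h
  have h0 := h.dotProduct_mulVec_nonneg ![1, 0, 1, 0, 0, 0, 0, 0, 0, 0, 0, 0]
  have h5 : 2 < Real.sqrt 5 := Real.lt_sqrt_of_sq_lt (by norm_num)
  simp [G17, dotProduct, Matrix.mulVec, Fin.sum_univ_succ] at h0
  linarith

theorem stmt_17 (hG : G17.IsHermitian) :
    (Finset.univ.filter fun j => 0 < hG.eigenvalues j).card = 9 ∧
    (Finset.univ.filter fun j => hG.eigenvalues j < 0).card = 1 ∧
    (Finset.univ.filter fun j => hG.eigenvalues j = 0).card = 2 ∧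
    G17.rank = 10 := by
  have hpos : 9 ≤ (Finset.univ.filter fun j => 0 < hG.eigenvalues j).card := by
    have h := le_sigPos_of_posDef _ G17_restrict_posDef
    rwa [hG.sigPos_toQuadraticForm', Pi.dim_spanSubset, Set.ncard_compl,
      show ({1, 2, 11} : Set (Fin 12)) = (({1, 2, 11} : Finset (Fin 12)) : Set (Fin 12)) by simp,
      Set.ncard_coe_finset, Nat.card_eq_fintype_card] at h
  have hneg : 0 < (Finset.univ.filter fun j => hG.eigenvalues j < 0).card := by
    rw [Finset.card_pos]
    by_contra h
    refine G17_not_posSemidef (hG.posSemidef_iff_eigenvalues_nonneg.mpr fun j => ?_)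
    rw [Finset.not_nonempty_iff_eq_empty, Finset.filter_eq_empty_iff] at h
    exact not_lt.mp (h (Finset.mem_univ j))
  have hzero : (Finset.univ.filter fun j => hG.eigenvalues j = 0).card + G17.rank = 12 := by
    rw [hG.rank_eq_card_non_zero_eigs, Fintype.card_subtype]
    simpa using Finset.card_filter_add_card_filter_not (s := Finset.univ)
      (fun j => hG.eigenvalues j = 0)
  have hsplit : (Finset.univ.filter fun j => 0 < hG.eigenvalues j).card +
      (Finset.univ.filter fun j => hG.eigenvalues j < 0).card = G17.rank := by
    rw [hG.rank_eq_card_non_zero_eigs, Fintype.card_subtype, ← Finset.card_union_of_disjoint]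
    · congr 1
      ext j
      simp [lt_or_lt_iff_ne, eq_comm]
    · exact Finset.disjoint_filter.mpr fun j _ h => not_lt.mpr h.le
  have := G17_rank_le
  lia
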